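/- Let I ⊂ R be a monomial ideal, let x_i be a variable, and let h_1,…,h_r be the monomials of G(I) in which x_i occurs. If x_i occurs with exponent exactly 1 in each h_j, and m is a positive integer, then I is Cohen–Macaulay of height g if and only if the monomial ideal generated by (G(I) \ {h_1,…,h_r}) ∪ {x_i^m h_1,…,x_i^m h_r} is Cohen–Macaulay of height g. -/

import Mathlib

open MvPolynomial

noncomputable section

/-- A monomial ideal of `K[x_1, …, x_n]`: an ideal generated by monomials. -/
def IsMonomialIdeal {n : ℕ} {K : Type*} [Field K] (I : Ideal (MvPolynomial (Fin n) K)) : Prop :=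
  ∃ S : Set (Fin n →₀ ℕ), I = Ideal.span ((fun a => monomial a (1 : K)) '' S)

/-- `u` lists the (unique) minimal monomial generating set `G(J)` of the monomial ideal `J`:
the monomials `x^{u i}` generate `J` and none of them is redundant. -/
def IsMinimalMonomialGens {n : ℕ} {K : Type*} [Field K] (J : Ideal (MvPolynomial (Fin n) K))
    {s : ℕ} (u : Fin s → (Fin n →₀ ℕ)) : Prop :=
  J = Ideal.span (Set.range fun i => monomial (u i) (1 : K)) ∧
    ∀ i : Fin s, monomial (u i) (1 : K) ∉
      Ideal.span ((fun i' => monomial (u i') (1 : K)) '' {i' | i' ≠ i})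

open RingTheory.Sequence in
/-- A (graded) ideal `I` of `R = K[x_1, …, x_n]` is Cohen–Macaulay if `R/I` is a
Cohen–Macaulay ring, i.e. there is a regular sequence on `R/I`, contained in the irrelevant
maximal ideal `(x_1, …, x_n)`, whose length equals the Krull dimension of `R/I`. -/
def IsCohenMacaulayIdeal {n : ℕ} {K : Type*} [Field K]
    (I : Ideal (MvPolynomial (Fin n) K)) : Prop :=
  ∃ rs : List (MvPolynomial (Fin n) K),
    (∀ f ∈ rs, f ∈ Ideal.span (Set.range (X : Fin n → MvPolynomial (Fin n) K))) ∧
    IsRegular (MvPolynomial (Fin n) K ⧸ I) rs ∧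
    (rs.length : WithBot ℕ∞) = ringKrullDim (MvPolynomial (Fin n) K ⧸ I)

/-- The height of an ideal `I`: the least height of a prime containing `I`. -/
def idealHeight {A : Type*} [CommRing A] (I : Ideal A) : ℕ∞ :=
  ⨅ p ∈ {p : PrimeSpectrum A | I ≤ p.asIdeal}, Order.height p

open Pointwise in
theorem smul_top_quotSMulTop_lt_top {B M : Type*} [CommRing B] [AddCommGroup M] [Module B M]
    {I : Ideal B} (hI : I • (⊤ : Submodule B M) < ⊤) {b : B} (hb : b ∈ I) :
    I • (⊤ : Submodule B (QuotSMulTop b M)) < ⊤ := by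
  refine lt_top_iff_ne_top.mpr fun eq => hI.ne ?_
  have := congrArg (Submodule.comap (Submodule.mkQ _)) eq
  simpa [Submodule.comap_smul_top_of_surjective I _ (Submodule.mkQ_surjective _),
    Submodule.smul_mono_left ((Ideal.span_singleton_le_iff_mem I).mpr hb),
    ← Submodule.ideal_span_singleton_smul] using this

open RingTheory.Sequence CategoryTheory Abelian Pointwise in
/-- Depth drops by exactly one modulo a regular element: any `b ∈ I` regular on `M` can replace
the first element of a regular sequence contained in `I`. -/
theorem exists_isRegular_quotSMulTop.{v} {B : Type*} [CommRing B] [IsNoetherianRing B] {M : Type v}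
    [AddCommGroup M] [Module B M] [Module.Finite B M] [Small.{v} B] (I : Ideal B)
    (hI : I • (⊤ : Submodule B M) < ⊤) {k : ℕ}
    (h : ∃ rs : List B, rs.length = k + 1 ∧ (∀ r ∈ rs, r ∈ I) ∧ IsRegular M rs)
    {b : B} (hb : b ∈ I) (hreg : IsSMulRegular M b) :
    ∃ rs : List B, rs.length = k ∧ (∀ r ∈ rs, r ∈ I) ∧ IsRegular (QuotSMulTop b M) rs := by
  have hext := ((ModuleCat.exists_isRegular_tfae I (k + 1) (ModuleCat.of B M) hI).out 3 1).mp h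
  refine ((ModuleCat.exists_isRegular_tfae I k (ModuleCat.of B (QuotSMulTop b M))
    (smul_top_quotSMulTop_lt_top hI hb)).out 1 3).mp fun j hj => ?_
  have zero1 := AddCommGrpCat.isZero_of_iff_subsingleton.mpr (hext j (by omega))
  have zero2 := AddCommGrpCat.isZero_of_iff_subsingleton.mpr (hext (j + 1) (by omega))
  have hreg' : IsSMulRegular (ModuleCat.of B M) b := hreg
  exact AddCommGrpCat.subsingleton_of_isZero <| ShortComplex.Exact.isZero_of_both_zeros
    ((Ext.covariant_sequence_exact₃' _ hreg'.smulShortComplex_shortExact) j (j + 1) rfl)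
    (zero1.eq_zero_of_src _) (zero2.eq_zero_of_tgt _)

open RingTheory.Sequence in
/-- A regular sequence contained in the radical of an extended ideal `𝔞 B` yields one of the same
length consisting of images of elements of `𝔞`. -/
theorem exists_isRegular_map.{v} {A B : Type*} [CommRing A] [CommRing B] [IsNoetherianRing B]
    (φ : A →+* B) (𝔞 : Ideal A) (I : Ideal B) (hle : 𝔞.map φ ≤ I) (hrad : I ≤ (𝔞.map φ).radical)
    (k : ℕ) {M : Type v} [AddCommGroup M] [Module B M] [Module.Finite B M] [Small.{v} B]
    (hI : I • (⊤ : Submodule B M) < ⊤)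
    (h : ∃ rs : List B, rs.length = k ∧ (∀ r ∈ rs, r ∈ I) ∧ IsRegular M rs) :
    ∃ rs : List A, rs.length = k ∧ (∀ r ∈ rs, r ∈ 𝔞) ∧ IsRegular M (rs.map φ) := by
  induction k generalizing M with
  | zero =>
    obtain ⟨rs, hlen, -, hrs⟩ := h
    obtain rfl := List.eq_nil_of_length_eq_zero hlen
    exact ⟨[], rfl, by simp, by simpa using hrs⟩
  | succ k ih =>
    obtain ⟨a, ha, hreg⟩ : ∃ a ∈ 𝔞, IsSMulRegular M (φ a) := by
      by_contra! hcon
      have hsub : (𝔞 : Set A) ⊆ ⋃ p ∈ associatedPrimes B M, (p.comap φ : Ideal A) := by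
        intro a ha
        have : φ a ∈ ⋃ p ∈ associatedPrimes B M, (p : Set B) := by
          rw [biUnion_associatedPrimes_eq_compl_regular B M]
          exact hcon a ha
        simpa using this
      obtain ⟨p, hp, hap⟩ := (Ideal.subset_union_prime_finite
        (associatedPrimes.finite B M) (f := fun p => p.comap φ) ⊥ ⊥
        (fun p hp _ _ => hp.isPrime.comap φ)).mp hsub
      have hIp : I ≤ p :=
        hrad.trans (hp.isPrime.radical_le_iff.mpr (Ideal.map_le_iff_le_comap.mpr hap))
      obtain ⟨rs, hlen, hmem, hrs⟩ := h
      match rs with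
      | [] => simp at hlen
      | r :: rs =>
        have hr : r ∈ ⋃ p ∈ associatedPrimes B M, (p : Set B) :=
          Set.mem_biUnion hp (hIp (hmem r (by simp)))
        rw [biUnion_associatedPrimes_eq_compl_regular B M] at hr
        exact hr ((isRegular_cons_iff _ _ _).mp hrs).1
    have haI : φ a ∈ I := hle (Ideal.mem_map_of_mem φ ha)
    have hq := exists_isRegular_quotSMulTop I hI h haI hreg
    obtain ⟨rs, hlen, hmem, hrs⟩ := ih (smul_top_quotSMulTop_lt_top hI haI) hq
    exact ⟨a :: rs, by simp [hlen], by simpa [ha] using hmem, by simpa using ⟨hreg, hrs⟩⟩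

open RingTheory.Sequence in
theorem isRegular_quotient_iff {A : Type*} [CommRing A] (J : Ideal A) (rs : List A) :
    IsRegular (A ⧸ J) rs ↔
      (∀ (k : ℕ) (hk : k < rs.length) (x : A),
        rs[k] * x ∈ J ⊔ Ideal.ofList (rs.take k) → x ∈ J ⊔ Ideal.ofList (rs.take k)) ∧
      J ⊔ Ideal.ofList rs ≠ ⊤ := by
  have key : ∀ (L : Ideal A), (L • (⊤ : Submodule A (A ⧸ J))).comap J.mkQ = J ⊔ L := by
    intro L
    rw [Submodule.comap_smul_top_of_surjective _ _ (Submodule.mkQ_surjective _)]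
    simp [sup_comm]
  rw [isRegular_iff, isWeaklyRegular_iff]
  refine and_congr (forall₂_congr fun k hk => ?_) ?_
  · rw [← key, isSMulRegular_iff_right_eq_zero_of_smul, (Submodule.mkQ_surjective _).forall,
      (Submodule.mkQ_surjective J).forall]
    refine forall_congr' fun x => ?_
    rw [← map_smul, ← map_smul]
    simp
  · rw [← key, ne_comm, not_iff_not, ← Submodule.comap_top (f := J.mkQ)]
    exact ((Submodule.comap_injective_of_surjective (Submodule.mkQ_surjective J)).eq_iff).symm

section Coordinates

variable {A B ι : Type*} [CommRing A] [CommRing B] [Fintype ι] {φ : A →+* B}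
  {p : ι → B →+ A} {e : ι → B}

theorem mem_map_iff_forall_coord_mem (hmul : ∀ k a b, p k (φ a * b) = a * p k b)
    (hsum : ∀ b, ∑ k, φ (p k b) * e k = b) (J : Ideal A) (b : B) :
    b ∈ J.map φ ↔ ∀ k, p k b ∈ J := by
  constructor
  · intro hb k
    refine Submodule.span_induction (p := fun b _ => ∀ c, p k (c * b) ∈ J) ?_ ?_ ?_ ?_ hb 1 |>
      fun h => by simpa using h
    · rintro _ ⟨a, ha, rfl⟩ c
      rw [mul_comm, hmul]
      exact J.mul_mem_right _ ha
    · simp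
    · intro x y _ _ hx hy c
      rw [mul_add, map_add]
      exact J.add_mem (hx c) (hy c)
    · intro d x _ hx c
      rw [smul_eq_mul, ← mul_assoc]
      exact hx _
  · intro h
    rw [← hsum b]
    exact sum_mem fun k _ => Ideal.mul_mem_right _ _ (Ideal.mem_map_of_mem φ (h k))

theorem map_mem_map_iff (hmul : ∀ k a b, p k (φ a * b) = a * p k b)
    (hsum : ∀ b, ∑ k, φ (p k b) * e k = b) {o : ι} (hone : p o 1 = 1) (J : Ideal A) (a : A) :
    φ a ∈ J.map φ ↔ a ∈ J := by
  refine ⟨fun h => ?_, Ideal.mem_map_of_mem φ⟩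
  have := (mem_map_iff_forall_coord_mem hmul hsum J _).mp h o
  rwa [← mul_one (φ a), hmul, hone, mul_one] at this

open RingTheory.Sequence in
theorem isRegular_quotient_map_iff (hmul : ∀ k a b, p k (φ a * b) = a * p k b)
    (hsum : ∀ b, ∑ k, φ (p k b) * e k = b) {o : ι} (hone : p o 1 = 1) (J : Ideal A)
    (rs : List A) :
    IsRegular (B ⧸ J.map φ) (rs.map φ) ↔ IsRegular (A ⧸ J) rs := by
  rw [isRegular_quotient_iff, isRegular_quotient_iff]
  simp only [← List.map_take, ← Ideal.map_ofList, ← Ideal.map_sup, List.length_map,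
    List.getElem_map]
  refine and_congr (forall₂_congr fun k hk => ?_) ?_
  · generalize J ⊔ Ideal.ofList (rs.take k) = L
    refine ⟨fun h x hx => ?_, fun h x hx => ?_⟩
    · rw [← map_mem_map_iff hmul hsum hone] at hx ⊢
      exact h _ (by rwa [← map_mul])
    · rw [mem_map_iff_forall_coord_mem hmul hsum] at hx ⊢
      exact fun j => h _ (by rw [← hmul]; exact hx j)
  · rw [Ne, Ne, Ideal.eq_top_iff_one, Ideal.eq_top_iff_one, ← map_one φ,
      map_mem_map_iff hmul hsum hone]

end Coordinates

theorem ringKrullDim_quotient_eq_of_radical_eq {A : Type*} [CommRing A] {I J : Ideal A}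
    (h : I.radical = J.radical) : ringKrullDim (A ⧸ I) = ringKrullDim (A ⧸ J) := by
  rw [ringKrullDim_quotient, ringKrullDim_quotient,
    (PrimeSpectrum.zeroLocus_eq_iff (I := I) (J := J)).mpr h]

theorem idealHeight_eq_of_radical_eq {A : Type*} [CommRing A] {I J : Ideal A}
    (h : I.radical = J.radical) : idealHeight I = idealHeight J := by
  have : {p : PrimeSpectrum A | I ≤ p.asIdeal} = {p : PrimeSpectrum A | J ≤ p.asIdeal} := by
    ext p
    rw [Set.mem_ofPred_eq, Set.mem_ofPred_eq, ← p.isPrime.radical_le_iff, h,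
      p.isPrime.radical_le_iff]
  rw [idealHeight, idealHeight, this]

section PowVariable

variable {n : ℕ} {K : Type*} [Field K]

/-- The `K`-algebra endomorphism of `K[x_1, …, x_n]` with `x_i ↦ x_i^q` fixing the other
variables. -/
def powVariable (K : Type*) [Field K] (i : Fin n) (q : ℕ) :
    MvPolynomial (Fin n) K →ₐ[K] MvPolynomial (Fin n) K :=
  aeval fun j => if j = i then X j ^ q else X j

theorem powVariable_monomial (i : Fin n) (q : ℕ) (e : Fin n →₀ ℕ) (c : K) :
    powVariable K i q (monomial e c) = monomial (e.update i (q * e i)) c := by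
  suffices h : powVariable K i q (monomial e 1) = monomial (e.update i (q * e i)) 1 by
    rw [← mul_one c, ← smul_eq_mul, ← smul_monomial, ← smul_monomial, map_smul, h]
  induction e using Finsupp.induction_linear with
  | zero => simp
  | add e f he hf =>
    rw [show monomial (e + f) (1 : K) = monomial e 1 * monomial f 1 by simp, map_mul, he, hf,
      monomial_mul, one_mul]
    refine congrArg (monomial · _) (Finsupp.ext fun j => ?_)
    by_cases hj : j = i <;> simp [hj, mul_add]
  | single j k =>
    rw [← X_pow_eq_monomial, map_pow, powVariable, aeval_X]
    split_ifs with hj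
    · subst hj
      rw [← pow_mul, X_pow_eq_monomial]
      refine congrArg (monomial · _) (Finsupp.ext fun l => ?_)
      by_cases hl : l = j <;> simp [hl]
    · rw [X_pow_eq_monomial]
      refine congrArg (monomial · _) (Finsupp.ext fun l => ?_)
      by_cases hl : l = i
      · subst hl; simp [hj]
      · simp [hl]

/-- The coefficient of `x_i^k` in the expansion of a polynomial in the basis `1, …, x_i^(q-1)` over
the subring `K[x_1, …, x_i^q, …, x_n]`. -/
def powVariableCoord (K : Type*) [Field K] (i : Fin n) (q : ℕ) (k : Fin q) :
    MvPolynomial (Fin n) K →ₗ[K] MvPolynomial (Fin n) K :=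
  (basisMonomials (Fin n) K).constr K fun e =>
    if e i % q = k then monomial (e.update i (e i / q)) 1 else 0

theorem powVariableCoord_monomial (i : Fin n) (q : ℕ) (k : Fin q) (e : Fin n →₀ ℕ) (c : K) :
    powVariableCoord K i q k (monomial e c) =
      if e i % q = k then monomial (e.update i (e i / q)) c else 0 := by
  have h : powVariableCoord K i q k (monomial e 1) =
      if e i % q = k then monomial (e.update i (e i / q)) 1 else 0 := by
    simpa [powVariableCoord] using (basisMonomials (Fin n) K).constr_basis K (fun e =>
      if e i % q = k then monomial (e.update i (e i / q)) (1 : K) else 0) e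
  rw [← mul_one c, ← smul_eq_mul, ← smul_monomial, map_smul, h, smul_ite, smul_zero,
    smul_monomial]

theorem powVariableCoord_mul (i : Fin n) {q : ℕ} (k : Fin q) (a b : MvPolynomial (Fin n) K) :
    powVariableCoord K i q k (powVariable K i q a * b) = a * powVariableCoord K i q k b := by
  have hq : 0 < q := k.pos
  induction a using MvPolynomial.induction_on' with
  | add a a' ha ha' => rw [map_add, add_mul, map_add, ha, ha', add_mul]
  | monomial e c =>
    induction b using MvPolynomial.induction_on' with
    | add b b' hb hb' => rw [mul_add, map_add, hb, hb', map_add, mul_add]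
    | monomial f d =>
      rw [powVariable_monomial, monomial_mul, powVariableCoord_monomial,
        powVariableCoord_monomial]
      simp only [Finsupp.coe_add, Pi.add_apply, Finsupp.coe_update, Function.update_self,
        Nat.mul_add_mod, mul_ite, mul_zero, monomial_mul]
      refine if_congr Iff.rfl ?_ rfl
      refine congrArg (monomial · _) (Finsupp.ext fun j => ?_)
      by_cases hj : j = i <;> simp [hj, Nat.mul_add_div hq]

theorem sum_powVariable_powVariableCoord (i : Fin n) {q : ℕ} (hq : 0 < q)
    (b : MvPolynomial (Fin n) K) :
    ∑ k : Fin q, powVariable K i q (powVariableCoord K i q k b) * X i ^ (k : ℕ) = b := by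
  induction b using MvPolynomial.induction_on' with
  | add b b' hb hb' => simp only [map_add, add_mul, Finset.sum_add_distrib, hb, hb']
  | monomial f d =>
    rw [Finset.sum_eq_single_of_mem ⟨f i % q, Nat.mod_lt _ hq⟩ (Finset.mem_univ _)]
    · rw [powVariableCoord_monomial, if_pos rfl, powVariable_monomial, X_pow_eq_monomial,
        monomial_mul, mul_one]
      refine congrArg (monomial · _) (Finsupp.ext fun j => ?_)
      by_cases hj : j = i
      · simp [hj, Nat.div_add_mod]
      · simp [hj]
    · intro k _ hk
      rw [powVariableCoord_monomial, if_neg, map_zero, zero_mul]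
      exact fun h => hk (Fin.ext h.symm)

theorem powVariableCoord_one (i : Fin n) (q : ℕ) [NeZero q] :
    powVariableCoord K i q 0 1 = 1 := by
  rw [← C_1, ← monomial_zero', powVariableCoord_monomial]
  simp

theorem radical_map_powVariable (i : Fin n) {q : ℕ} (hq : 0 < q)
    {I : Ideal (MvPolynomial (Fin n) K)} (hI : IsMonomialIdeal I) :
    (I.map (powVariable K i q : MvPolynomial (Fin n) K →+* MvPolynomial (Fin n) K)).radical =
      I.radical := by
  obtain ⟨S, rfl⟩ := hI
  apply le_antisymm
  · refine Ideal.radical_mono ?_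
    rw [Ideal.map_span, Ideal.span_le]
    rintro _ ⟨_, ⟨e, he, rfl⟩, rfl⟩
    refine Ideal.mem_of_dvd _ ?_ (Ideal.subset_span ⟨e, he, rfl⟩)
    simp only [RingHom.coe_coe, powVariable_monomial]
    refine monomial_dvd_monomial.mpr ⟨Or.inr fun j => ?_, dvd_rfl⟩
    by_cases hj : j = i
    · subst hj
      simpa using Nat.le_mul_of_pos_left _ hq
    · simp [hj]
  · rw [Ideal.radical_le_radical_iff, Ideal.span_le]
    rintro _ ⟨e, he, rfl⟩
    refine ⟨q, Ideal.mem_of_dvd _ ?_ (Ideal.mem_map_of_mem _ (Ideal.subset_span ⟨e, he, rfl⟩))⟩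
    simp only [RingHom.coe_coe, powVariable_monomial, monomial_pow]
    refine monomial_dvd_monomial.mpr ⟨Or.inr fun j => ?_, by simp⟩
    by_cases hj : j = i
    · simp [hj]
    · simpa [hj] using Nat.le_mul_of_pos_left _ hq

theorem IsMonomialIdeal.le_span_X {J : Ideal (MvPolynomial (Fin n) K)} (hJ : IsMonomialIdeal J)
    (hne : J ≠ ⊤) : J ≤ Ideal.span (Set.range X) := by
  obtain ⟨S, rfl⟩ := hJ
  rw [Ideal.span_le]
  rintro _ ⟨e, he, rfl⟩
  have he0 : e ≠ 0 := by
    rintro rfl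
    exact hne ((Ideal.eq_top_iff_one _).mpr (Ideal.subset_span ⟨0, he, by simp⟩))
  obtain ⟨j, hj⟩ := Finsupp.ne_iff.mp he0
  exact Ideal.mem_of_dvd _ (X_dvd_monomial.mpr (Or.inr hj)) (Ideal.subset_span ⟨j, rfl⟩)

theorem span_X_ne_top : Ideal.span (Set.range (X : Fin n → MvPolynomial (Fin n) K)) ≠ ⊤ := by
  have hle : Ideal.span (Set.range (X : Fin n → MvPolynomial (Fin n) K)) ≤
      RingHom.ker (constantCoeff (R := K) (σ := Fin n)) := by
    rw [Ideal.span_le]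
    rintro _ ⟨j, rfl⟩
    simp
  exact fun h => RingHom.ker_ne_top (constantCoeff (R := K) (σ := Fin n)) (top_le_iff.mp (h ▸ hle))

theorem map_powVariable_span_X_le (i : Fin n) {q : ℕ} (hq : 0 < q) :
    (Ideal.span (Set.range X)).map
      (powVariable K i q : MvPolynomial (Fin n) K →+* MvPolynomial (Fin n) K) ≤
      Ideal.span (Set.range X) := by
  rw [Ideal.map_span, Ideal.span_le]
  rintro _ ⟨_, ⟨j, rfl⟩, rfl⟩
  have hj : (X j : MvPolynomial (Fin n) K) ∈ Ideal.span (Set.range X) :=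
    Ideal.subset_span ⟨j, rfl⟩
  simp only [RingHom.coe_coe, powVariable, aeval_X]
  split_ifs
  · exact Ideal.pow_mem_of_mem _ hj q hq
  · exact hj

/-- The substitution `x_i ↦ x_i^q` preserves and reflects Cohen–Macaulayness of monomial ideals. -/
theorem isCohenMacaulayIdeal_map_powVariable_iff (i : Fin n) {q : ℕ} (hq : 0 < q)
    {I : Ideal (MvPolynomial (Fin n) K)} (hI : IsMonomialIdeal I) :
    IsCohenMacaulayIdeal
      (I.map (powVariable K i q : MvPolynomial (Fin n) K →+* MvPolynomial (Fin n) K)) ↔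
      IsCohenMacaulayIdeal I := by
  have : NeZero q := ⟨hq.ne'⟩
  set φ := (powVariable K i q : MvPolynomial (Fin n) K →+* MvPolynomial (Fin n) K) with hφ
  have hdim := ringKrullDim_quotient_eq_of_radical_eq (radical_map_powVariable i hq hI)
  have hreg := isRegular_quotient_map_iff (φ := φ)
    (p := fun k => (powVariableCoord K i q k).toAddMonoidHom)
    (powVariableCoord_mul i) (sum_powVariable_powVariableCoord i hq) (powVariableCoord_one i q) I
  have hmap := map_powVariable_span_X_le (K := K) i hq
  constructor
  · rintro ⟨rs, hmem, hrs, hlen⟩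
    have hX : IsMonomialIdeal
        (Ideal.span (Set.range (X : Fin n → MvPolynomial (Fin n) K))) :=
      ⟨Set.range fun j => Finsupp.single j 1, by rw [← Set.range_comp]; rfl⟩
    have hle : I.map φ ≤ Ideal.span (Set.range (X : Fin n → MvPolynomial (Fin n) K)) := by
      have hne : I ≠ ⊤ := by
        rintro rfl
        have := hrs.nontrivial
        rw [Ideal.map_top] at this
        exact Ideal.Quotient.nontrivial_iff.mp this rfl
      exact (Ideal.map_mono (hI.le_span_X hne)).trans hmap
    have hlt : Ideal.span (Set.range (X : Fin n → MvPolynomial (Fin n) K)) •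
        (⊤ : Submodule (MvPolynomial (Fin n) K) (MvPolynomial (Fin n) K ⧸ I.map φ)) < ⊤ := by
      refine lt_top_iff_ne_top.mpr fun h => span_X_ne_top (n := n) (K := K) ?_
      have := congrArg (Submodule.comap (I.map φ).mkQ) h
      rw [Submodule.comap_smul_top_of_surjective _ _ (Submodule.mkQ_surjective _)] at this
      simpa [hle] using this
    obtain ⟨ss, hss, hsmem, hsreg⟩ := exists_isRegular_map φ (Ideal.span (Set.range X))
      (Ideal.span (Set.range X)) hmap
      (by rw [hφ, radical_map_powVariable i hq hX]; exact Ideal.le_radical)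
      rs.length hlt ⟨rs, rfl, hmem, hrs⟩
    exact ⟨ss, hsmem, (hreg ss).mp hsreg, by rw [hss, hlen, hdim]⟩
  · rintro ⟨rs, hmem, hrs, hlen⟩
    refine ⟨rs.map φ, ?_, (hreg rs).mpr hrs, by rw [List.length_map, hlen, hdim]⟩
    intro f hf
    obtain ⟨r, hr, rfl⟩ := List.mem_map.mp hf
    exact hmap (Ideal.mem_map_of_mem φ (hmem r hr))

end PowVariable

/-- Let `I` be a monomial ideal and `x_i` a variable occurring with
exponent exactly `1` in every minimal generator of `I` in which it occurs. For `m ≥ 1`,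
`I` is Cohen–Macaulay of height `g` iff the ideal obtained by multiplying by `x_i^m` each
minimal generator containing `x_i` is Cohen–Macaulay of height `g`. -/
theorem cm_of_height_iff_scale_variable
    {n : ℕ} {K : Type*} [Field K] (I : Ideal (MvPolynomial (Fin n) K))
    (hI : IsMonomialIdeal I)
    {s : ℕ} (v : Fin s → (Fin n →₀ ℕ)) (hgen : IsMinimalMonomialGens I v)
    (i : Fin n) (hexp : ∀ a, v a i ≤ 1)
    (m : ℕ) (hm : 1 ≤ m) (g : ℕ∞)
    (I' : Ideal (MvPolynomial (Fin n) K))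
    (hI' : I' = Ideal.span {f | ∃ a : Fin s,
      f = monomial (if 1 ≤ v a i then v a + Finsupp.single i m else v a) (1 : K)}) :
    (IsCohenMacaulayIdeal I ∧ idealHeight I = g) ↔
      (IsCohenMacaulayIdeal I' ∧ idealHeight I' = g) := by
  have hmap : I' = I.map
      (powVariable K i (m + 1) : MvPolynomial (Fin n) K →+* MvPolynomial (Fin n) K) := by
    rw [hI', hgen.1, Ideal.map_span, ← Set.range_comp]
    congr 1
    ext f
    refine exists_congr fun a => ?_
    rw [eq_comm]
    refine Eq.congr_left ?_
    simp only [Function.comp_apply, RingHom.coe_coe, powVariable_monomial]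
    refine congrArg (monomial · _) (Finsupp.ext fun j => ?_)
    have ha := hexp a
    by_cases hj : j = i
    · subst hj
      split_ifs with h
      · simp [le_antisymm ha h, add_comm]
      · simp [Nat.lt_one_iff.mp (not_le.mp h)]
    · split_ifs <;> simp [hj]
  rw [hmap, isCohenMacaulayIdeal_map_powVariable_iff i m.succ_pos hI,
    idealHeight_eq_of_radical_eq (radical_map_powVariable i m.succ_pos hI)]
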